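/- Let n ≥ 1 be an integer, let ξ ∈ ℝ^{n+1} have ℚ-linearly independent coordinates, and let S ⊆ ℤ^{n+1}. If λ̂(ξ;S) > 0 and λ(ξ;S) < ∞, then λ̂(ξ;S) + λ̂(ξ;S)²/λ(ξ;S) + ⋯ + λ̂(ξ;S)ⁿ/λ(ξ;S)^{n−1} ≤ 1. -/

import Mathlib

open Filter

/-- Euclidean norm of an integer point of `ℤ^{n+1}`. -/
noncomputable def inorm {n : ℕ} (x : Fin (n + 1) → ℤ) : ℝ :=
  Real.sqrt (∑ k, ((x k : ℝ)) ^ 2)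

/-- `L_ξ(x) = max_{1 ≤ k ≤ n} |ξ₀ x_k − ξ_k x₀|` (the term `k = 0` vanishes, so the
maximum over all `k` agrees with the maximum over `1 ≤ k ≤ n` when `n ≥ 1`). -/
noncomputable def Lxi {n : ℕ} (ξ : Fin (n + 1) → ℝ) (x : Fin (n + 1) → ℤ) : ℝ :=
  Finset.univ.sup' Finset.univ_nonempty fun k => |ξ 0 * (x k : ℝ) - ξ k * (x 0 : ℝ)|

/-- `𝓛_ξ(X; S) = min { L_ξ(x) : x ∈ S, 0 < ‖x‖ ≤ X }`, with the convention `min ∅ = ∞`. -/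
noncomputable def calL {n : ℕ} (ξ : Fin (n + 1) → ℝ) (S : Set (Fin (n + 1) → ℤ)) (X : ℝ) :
    ENNReal :=
  sInf { l | ∃ x ∈ S, x ≠ 0 ∧ inorm x ≤ X ∧ l = ENNReal.ofReal (Lxi ξ x) }


/-- The ordinary exponent `λ(ξ; S) = sup { λ ≥ 0 : liminf_{X→∞} X^λ 𝓛_ξ(X;S) < ∞ }`,
as an extended nonnegative real. -/
noncomputable def lamOrd {n : ℕ} (ξ : Fin (n + 1) → ℝ) (S : Set (Fin (n + 1) → ℤ)) : ENNReal :=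
  sSup { l | ∃ t : ℝ, 0 ≤ t ∧ l = ENNReal.ofReal t ∧
    Filter.liminf (fun X : ℝ => ENNReal.ofReal (X ^ t) * calL ξ S X) Filter.atTop < ⊤ }

/-- The uniform exponent `λ̂(ξ; S) = sup { λ ≥ 0 : limsup_{X→∞} X^λ 𝓛_ξ(X;S) < ∞ }`. -/
noncomputable def lamHat {n : ℕ} (ξ : Fin (n + 1) → ℝ) (S : Set (Fin (n + 1) → ℤ)) : ENNReal :=
  sSup { l | ∃ t : ℝ, 0 ≤ t ∧ l = ENNReal.ofReal t ∧
    Filter.limsup (fun X : ℝ => ENNReal.ofReal (X ^ t) * calL ξ S X) Filter.atTop < ⊤ }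


/-- Pure linear-arithmetic heart: no tail of exponents survives. -/
lemma mm_arith (n : ℕ) (hn : 1 ≤ n) (α θ : ℝ) (hα : 0 < α) (hθ : 0 < θ)
    (hviol : 1 < α * ∑ k ∈ Finset.range n, θ ^ k) :
    ∃ δ : ℝ, 0 < δ ∧ ∀ u v : ℕ → ℝ, 0 ≤ u 0 → (∀ d, d < n → u d ≤ v (d + 1)) →
      (∀ d, d < n → v (d + 1) ≤ u (d + 1)) → (∀ d, d < n → θ * u (d + 1) ≤ v (d + 1)) →
      u 0 + ∑ d ∈ Finset.range n, ((1 - α) * u (d + 1) - v (d + 1)) ≤ - δ * u 0 := by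
  let ν : ℕ → ℝ := fun m => Nat.rec 1 (fun _ r => max (r - α) 0 / θ) m
  have ν0 : ν 0 = 1 := rfl
  have νs : ∀ m, ν (m + 1) = max (ν m - α) 0 / θ := fun m => rfl
  have νnn : ∀ m, 0 ≤ ν m := by
    intro m
    cases m with
    | zero => rw [ν0]; norm_num
    | succ m => rw [νs]; positivity
  have νform : ∀ m, 0 < ν m → θ ^ m * ν m = 1 - α * ∑ k ∈ Finset.range m, θ ^ k := by
    intro m
    induction m with
    | zero => intro _; simp [ν0]
    | succ m ih =>
      intro h
      rw [νs] at h
      have h1 : 0 < ν m - α := by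
        by_contra hc
        rw [max_eq_right (not_lt.mp hc)] at h
        simp at h
      have h2 := ih (by linarith)
      rw [νs, max_eq_left h1.le, Finset.sum_range_succ, pow_succ]
      field_simp
      linarith
  have νlast : ν (n - 1) < α := by
    by_contra hc
    push Not at hc
    have h := νform (n - 1) (by linarith)
    obtain ⟨k, rfl⟩ : ∃ k, n = k + 1 := ⟨n - 1, by omega⟩
    simp only [Nat.add_sub_cancel] at *
    rw [Finset.sum_range_succ] at hviol
    have : θ ^ k * α ≤ θ ^ k * ν k := by gcongr
    nlinarith
  have νmono : ∀ x y : ℝ, x ≤ y → max (x - α) 0 / θ ≤ max (y - α) 0 / θ := by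
    intro x y h
    gcongr
  have ν1v : ν 1 = max (1 - α) 0 / θ := rfl
  have ν1 : ν 1 ≤ 1 := by
    by_contra hc
    push Not at hc
    have h1 : ∀ m, 1 ≤ ν m := by
      intro m
      induction m with
      | zero => rw [ν0]
      | succ m ih =>
        have := νmono _ _ ih
        rw [ν1v] at hc
        rw [νs]; linarith
    have h2 := h1 (n - 1)
    rw [ν1v, max_eq_right (by linarith)] at hc
    simp at hc
    linarith
  have νle : ∀ m, ν m ≤ 1 := by
    intro m
    induction m with
    | zero => rw [ν0]
    | succ m ih =>
      have := νmono _ _ ih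
      rw [ν1v] at ν1
      rw [νs]; linarith
  refine ⟨α - ν (n - 1), by linarith, ?_⟩
  intro u v hu0 huv hvu hθu
  have hunn : ∀ d, d ≤ n → 0 ≤ u d := by
    intro d
    induction d with
    | zero => intro _; exact hu0
    | succ d ih =>
      intro h
      linarith [ih (by omega), huv d (by omega), hvu d (by omega)]
  have key : ∀ m, m ≤ n → ∑ d ∈ Finset.Ico (n - m) n, ((1 - α) * u (d + 1) - v (d + 1))
      ≤ (ν m - 1) * u (n - m) := by
    intro m
    induction m with
    | zero => intro _; simp [ν0]
    | succ m ih =>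
      intro h
      have ih := ih (by omega)
      rw [Finset.sum_eq_sum_Ico_succ_bot (by omega)]
      obtain ⟨j, hj⟩ : ∃ j, n - (m + 1) = j := ⟨_, rfl⟩
      have hj' : n - m = j + 1 := by omega
      rw [hj] at *
      rw [hj'] at ih
      have a1 := huv j (by omega)
      have a2 := hvu j (by omega)
      have a3 := hθu j (by omega)
      have a4 := hunn j (by omega)
      have a5 := hunn (j+1) (by omega)
      have b1 : (ν m - α) * u (j + 1) ≤ max (ν m - α) 0 * u (j + 1) := by
        gcongr; exact le_max_left _ _
      have b2 : max (ν m - α) 0 * u (j + 1) ≤ ν (m + 1) * v (j + 1) := by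
        have : max (ν m - α) 0 = ν (m + 1) * θ := by rw [νs]; field_simp
        rw [this, mul_assoc]
        exact mul_le_mul_of_nonneg_left a3 (νnn (m + 1))
      have b3 : (1 - ν (m + 1)) * u j ≤ (1 - ν (m + 1)) * v (j + 1) :=
        mul_le_mul_of_nonneg_left a1 (by linarith [νle (m + 1)])
      nlinarith
  obtain ⟨k, rfl⟩ : ∃ k, n = k + 1 := ⟨n - 1, by omega⟩
  have h := key k (by omega)
  rw [Finset.range_eq_Ico, Finset.sum_eq_sum_Ico_succ_bot (by omega)]
  simp only [Nat.add_sub_cancel, Nat.add_sub_cancel_left, zero_add] at *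
  have a1 := huv 0 (by omega)
  have a2 := hvu 0 (by omega)
  simp only [zero_add] at a1 a2
  have : (α - ν k) * u 0 ≤ (α - ν k) * u 1 :=
    mul_le_mul_of_nonneg_left (by linarith) (by linarith)
  nlinarith

/-- Greedy extraction of a basis. -/
lemma mm_chain {n : ℕ} {K E : Type*} [Field K] [AddCommGroup E] [Module K E]
    (hdim : Module.finrank K E = n + 1) (x : ℕ → E) (a : ℕ) (hxa : x a ≠ 0)
    (hspan : ∀ W : Submodule K E, W ≠ ⊤ → ∃ m, a ≤ m ∧ x m ∉ W) :
    ∃ s : ℕ → ℕ, s 0 = a ∧ (∀ d, d < n → s d < s (d + 1)) ∧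
      LinearIndependent K (fun e : Fin (n + 1) => x (s e)) ∧
      ∀ d, d < n → x (s (d + 1) - 1) ∈
        Submodule.span K (Set.range (fun e : Fin (d + 1) => x (s e))) := by
  classical
  have h1 : ∀ W : Submodule K E, ∃ m, W ≠ ⊤ → a ≤ m ∧ x m ∉ W ∧ ∀ k, a ≤ k → k < m → x k ∈ W := by
    intro W
    by_cases hW : W = ⊤
    · exact ⟨0, fun h => absurd hW h⟩
    · have h := hspan W hW
      refine ⟨Nat.find h, fun _ => ⟨(Nat.find_spec h).1, (Nat.find_spec h).2, ?_⟩⟩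
      intro k hk hk2
      by_contra hc
      exact Nat.find_min h hk2 ⟨hk, hc⟩
  choose nxt hnxt using h1
  let W : ℕ → Submodule K E := fun d =>
    Nat.rec (Submodule.span K {x a}) (fun _ V => V ⊔ Submodule.span K {x (nxt V)}) d
  let s : ℕ → ℕ := fun d => Nat.casesOn d a (fun d => nxt (W d))
  have W0 : W 0 = Submodule.span K {x a} := rfl
  have Ws : ∀ d, W (d + 1) = W d ⊔ Submodule.span K {x (s (d + 1))} := fun d => rfl
  have s0 : s 0 = a := rfl
  have ss : ∀ d, s (d + 1) = nxt (W d) := fun d => rfl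
  have Wspan : ∀ d, W d = Submodule.span K (Set.range (fun e : Fin (d + 1) => x (s e))) := by
    intro d
    induction d with
    | zero =>
      rw [W0]; congr 1
      ext y
      simp [s0]
    | succ d ih =>
      rw [Ws, ih, ← Submodule.span_union]
      congr 1
      ext y
      simp only [Set.union_singleton, Set.mem_insert_iff, Set.mem_range]
      rw [Fin.exists_iff_castSucc (n := d + 1)] <;> simp [or_comm, eq_comm]
  have Wtop : ∀ d, d < n → W d ≠ ⊤ := by
    intro d hd h
    have h2 := finrank_range_le_card (R := K) (fun e : Fin (d + 1) => x (s e))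
    rw [Set.finrank, ← Wspan, h, finrank_top, hdim] at h2
    simp at h2
    omega
  have Wmem : ∀ d, d ≤ n → ∀ k, a ≤ k → k ≤ s d → x k ∈ W d := by
    intro d hd k hk hk2
    cases d with
    | zero =>
      have : k = a := by rw [s0] at hk2; omega
      rw [W0, this]; exact Submodule.mem_span_singleton_self _
    | succ d =>
      rw [Ws]
      rcases hk2.lt_or_eq with h | h
      · exact Submodule.mem_sup_left ((hnxt (W d) (Wtop d (by omega))).2.2 k hk h)
      · rw [h]; exact Submodule.mem_sup_right (Submodule.mem_span_singleton_self _)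
  have snot : ∀ d, d < n → x (s (d + 1)) ∉ W d := fun d hd => (hnxt (W d) (Wtop d hd)).2.1
  have slt : ∀ d, d < n → s d < s (d + 1) := by
    intro d hd
    exact lt_of_not_ge fun hc =>
      snot d hd (Wmem d hd.le _ (hnxt (W d) (Wtop d hd)).1 hc)
  have sa : ∀ d, d ≤ n → a ≤ s d := by
    intro d
    induction d with
    | zero => intro _; exact s0.ge
    | succ d ih => intro h; have := slt d (by omega); have := ih (by omega); omega
  refine ⟨s, s0, slt, ?_, ?_⟩
  · have : ∀ d, d ≤ n → LinearIndependent K (fun e : Fin (d + 1) => x (s e)) := by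
      intro d
      induction d with
      | zero =>
        intro _
        rw [linearIndependent_finSucc']
        refine ⟨linearIndependent_empty_type, ?_⟩
        simpa [s0] using hxa
      | succ d ih =>
        intro h
        rw [linearIndependent_finSucc']
        refine ⟨ih (by omega), ?_⟩
        have := snot d (by omega)
        rw [Wspan] at this
        exact this
    exact this n le_rfl
  · intro d hd
    rw [← Wspan]
    have := slt d hd
    have := sa d hd.le
    exact (hnxt (W d) (Wtop d hd)).2.2 _ (by omega) (by rw [ss] at *; omega)

lemma mm_det {N : ℕ} (y : Matrix (Fin N) (Fin N) ℤ) (hdet : y.det ≠ 0)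
    (t : Matrix (Fin N) (Fin N) ℝ) (ht : ∀ i j, i ≤ j → t i j = 0) (b : Fin N → ℝ)
    (hb : ∀ i k, |(y i k : ℝ) - ∑ j, t i j * (y j k : ℝ)| ≤ b i) :
    1 ≤ (N.factorial : ℝ) * ∏ i, b i := by
  classical
  set Y : Matrix (Fin N) (Fin N) ℝ := y.map (Int.castRingHom ℝ) with hY
  have hYdet : Y.det = (y.det : ℝ) := by
    rw [hY]
    exact ((Int.castRingHom ℝ).map_det y).symm
  have hT : (1 - t).det = 1 := by
    rw [Matrix.det_of_isLowerTriangular]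
    · apply Finset.prod_eq_one
      intro i _
      simp [ht i i le_rfl]
    · intro i j hij
      have hij' : i < j := by simpa using hij
      simp [ht i j hij'.le, hij'.ne]
  have hZ : ((1 - t) * Y).det = (y.det : ℝ) := by rw [Matrix.det_mul, hT, one_mul, hYdet]
  have h1 : (1 : ℝ) ≤ |((1 - t) * Y).det| := by
    rw [hZ]
    exact_mod_cast Int.one_le_abs hdet
  have hentry : ∀ i k, |((1 - t) * Y) i k| ≤ b i := by
    intro i k
    have : ((1 - t) * Y) i k = (y i k : ℝ) - ∑ j, t i j * (y j k : ℝ) := by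
      rw [sub_mul, one_mul, Matrix.sub_apply, Matrix.mul_apply]
      simp [hY]
    rw [this]; exact hb i k
  refine h1.trans ?_
  rw [Matrix.det_apply]
  refine (Finset.abs_sum_le_sum_abs _ _).trans ?_
  have : ∀ σ ∈ (Finset.univ : Finset (Equiv.Perm (Fin N))),
      |Equiv.Perm.sign σ • ∏ i, ((1 - t) * Y) (σ i) i| ≤ ∏ i, b i := by
    intro σ _
    have e1 : |Equiv.Perm.sign σ • ∏ i, ((1 - t) * Y) (σ i) i|
        = ∏ i, |((1 - t) * Y) (σ i) i| := by
      rw [← Finset.abs_prod]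
      rcases Int.units_eq_one_or (Equiv.Perm.sign σ) with h | h <;> rw [h] <;> simp
    rw [e1, ← Equiv.prod_comp σ b]
    exact Finset.prod_le_prod (fun _ _ => abs_nonneg _) (fun i _ => hentry _ _)
  refine (Finset.sum_le_card_nsmul _ _ _ this).trans ?_
  rw [Finset.card_univ, Fintype.card_perm, Fintype.card_fin, nsmul_eq_mul]

lemma inorm_nonneg {n : ℕ} (x : Fin (n + 1) → ℤ) : 0 ≤ inorm x := Real.sqrt_nonneg _

lemma abs_le_inorm {n : ℕ} (x : Fin (n + 1) → ℤ) (k : Fin (n + 1)) : |(x k : ℝ)| ≤ inorm x := by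
  apply Real.abs_le_sqrt
  exact Finset.single_le_sum (f := fun k => ((x k : ℝ)) ^ 2) (fun i _ => sq_nonneg _)
    (Finset.mem_univ k)

lemma one_le_inorm {n : ℕ} (x : Fin (n + 1) → ℤ) (hx : x ≠ 0) : 1 ≤ inorm x := by
  obtain ⟨k, hk⟩ := Function.ne_iff.mp hx
  refine le_trans ?_ (abs_le_inorm x k)
  exact_mod_cast Int.one_le_abs hk

lemma inorm_le_of {n : ℕ} (x : Fin (n + 1) → ℤ) (B : ℝ) (hB : 0 ≤ B)
    (h : ∀ k, |(x k : ℝ)| ≤ B) : inorm x ≤ (n + 1) * B := by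
  apply Real.sqrt_le_iff.mpr
  refine ⟨by positivity, ?_⟩
  have : ∑ k, ((x k : ℝ)) ^ 2 ≤ ∑ _k : Fin (n + 1), B ^ 2 := by
    apply Finset.sum_le_sum
    intro k _
    exact sq_le_sq' (by linarith [neg_abs_le (x k : ℝ), h k]) (by linarith [le_abs_self (x k : ℝ), h k])
  simp only [Finset.sum_const, Finset.card_univ, Fintype.card_fin, nsmul_eq_mul] at this
  push_cast at this
  have h2 : (0:ℝ) ≤ n := Nat.cast_nonneg n
  nlinarith [sq_nonneg B, mul_nonneg h2 (sq_nonneg B), mul_nonneg (mul_nonneg h2 h2) (sq_nonneg B)]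

lemma abs_le_Lxi {n : ℕ} (ξ : Fin (n + 1) → ℝ) (x : Fin (n + 1) → ℤ) (k : Fin (n + 1)) :
    |ξ 0 * (x k : ℝ) - ξ k * (x 0 : ℝ)| ≤ Lxi ξ x :=
  Finset.le_sup' (fun k => |ξ 0 * (x k : ℝ) - ξ k * (x 0 : ℝ)|) (Finset.mem_univ k)

lemma Lxi_nonneg {n : ℕ} (ξ : Fin (n + 1) → ℝ) (x : Fin (n + 1) → ℤ) : 0 ≤ Lxi ξ x :=
  (abs_nonneg _).trans (abs_le_Lxi ξ x 0)

lemma Lxi_pos {n : ℕ} (hn : 1 ≤ n) (ξ : Fin (n + 1) → ℝ) (hξ : LinearIndependent ℚ ξ)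
    (x : Fin (n + 1) → ℤ) (hx : x ≠ 0) : 0 < Lxi ξ x := by
  refine lt_of_le_of_ne (Lxi_nonneg ξ x) fun h0 => hx ?_
  have key : ∀ k, k ≠ 0 → x k = 0 ∧ x 0 = 0 := by
    intro k hk
    have h1 := abs_le_Lxi ξ x k
    rw [← h0] at h1
    have h2 : ξ 0 * (x k : ℝ) - ξ k * (x 0 : ℝ) = 0 := abs_nonpos_iff.mp h1
    have h3 := (Fintype.linearIndependent_iff.mp hξ)
      (Pi.single 0 (x k : ℚ) - Pi.single k (x 0 : ℚ)) (by
        simp only [Pi.sub_apply, sub_smul, Finset.sum_sub_distrib, Pi.single_apply, ite_smul,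
          zero_smul, Finset.sum_ite_eq', Finset.mem_univ, if_true]
        rw [Rat.smul_def, Rat.smul_def]
        push_cast
        linarith)
    have h4 := h3 k
    have h5 := h3 0
    simp [hk, Ne.symm hk] at h4 h5
    exact ⟨h5, h4⟩
  ext k
  by_cases hk : k = 0
  · subst hk
    exact (key (Fin.last n) (by simp [Fin.ext_iff]; omega)).2
  · exact (key k hk).1

lemma mm_hat {n : ℕ} (ξ : Fin (n + 1) → ℝ) (S : Set (Fin (n + 1) → ℤ)) (α : ℝ)
    (h : ENNReal.ofReal α < lamHat ξ S) :
    ∃ X0 : ℝ, 1 ≤ X0 ∧ ∀ X, X0 ≤ X → ∃ x ∈ S, x ≠ 0 ∧ inorm x ≤ X ∧ Lxi ξ x ≤ X ^ (-α) := by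
  obtain ⟨l, ⟨t, ht0, rfl, ht⟩, hl⟩ := lt_sSup_iff.mp h
  have hαt : α < t := ENNReal.ofReal_lt_ofReal_iff'.mp hl |>.1
  obtain ⟨M, hM1, hM2⟩ := exists_between ht
  have hev := Filter.eventually_lt_of_limsup_lt hM1
  have htop : Tendsto (fun X : ℝ => X ^ (t - α)) atTop atTop :=
    tendsto_rpow_atTop (by linarith)
  have hev2 := htop.eventually_gt_atTop M.toReal
  obtain ⟨X0, hX0⟩ := Filter.eventually_atTop.mp ((hev.and hev2).and (eventually_ge_atTop 1))
  refine ⟨max X0 1, le_max_right _ _, fun X hX => ?_⟩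
  obtain ⟨⟨h1, h2⟩, h3⟩ := hX0 X ((le_max_left _ _).trans hX)
  have hXpos : 0 < X := by linarith
  have h4 : calL ξ S X < ENNReal.ofReal (X ^ (-α)) := by
    by_contra hc
    push Not at hc
    have h5 : ENNReal.ofReal (X ^ t) * ENNReal.ofReal (X ^ (-α)) < M :=
      lt_of_le_of_lt (by gcongr) h1
    rw [← ENNReal.ofReal_mul (by positivity), ← Real.rpow_add hXpos, ← sub_eq_add_neg] at h5
    have := (ENNReal.ofReal_lt_iff_lt_toReal (by positivity) hM2.ne).mp h5
    linarith
  obtain ⟨l, ⟨x, hxS, hx0, hxX, rfl⟩, hl⟩ := sInf_lt_iff.mp h4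
  exact ⟨x, hxS, hx0, hxX, (ENNReal.ofReal_lt_ofReal_iff'.mp hl).1.le⟩

lemma mm_ord {n : ℕ} (ξ : Fin (n + 1) → ℝ) (S : Set (Fin (n + 1) → ℤ)) (β : ℝ) (hβ : 0 ≤ β)
    (h : lamOrd ξ S < ENNReal.ofReal β) :
    ∃ X1 : ℝ, ∀ x ∈ S, x ≠ 0 → X1 ≤ inorm x → (inorm x) ^ (-β) ≤ Lxi ξ x := by
  have h1 : ¬ (Filter.liminf (fun X : ℝ => ENNReal.ofReal (X ^ β) * calL ξ S X) Filter.atTop < ⊤) := by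
    intro hc
    have : ENNReal.ofReal β ≤ lamOrd ξ S := by
      unfold lamOrd
      apply le_sSup
      exact ⟨β, hβ, rfl, hc⟩
    exact absurd this (not_le.mpr h)
  have h2 : (1 : ENNReal) <
      Filter.liminf (fun X : ℝ => ENNReal.ofReal (X ^ β) * calL ξ S X) Filter.atTop :=
    lt_of_lt_of_le ENNReal.one_lt_top (not_lt.mp h1)
  obtain ⟨X1, hX1⟩ := Filter.eventually_atTop.mp (Filter.eventually_lt_of_lt_liminf h2)
  refine ⟨X1, fun x hxS hx0 hx => ?_⟩
  have hpos : 0 < inorm x := by linarith [one_le_inorm x hx0]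
  have h3 := hX1 _ hx
  have h4 : calL ξ S (inorm x) ≤ ENNReal.ofReal (Lxi ξ x) := sInf_le ⟨x, hxS, hx0, le_rfl, rfl⟩
  have h5 : (1 : ENNReal) < ENNReal.ofReal (inorm x ^ β) * ENNReal.ofReal (Lxi ξ x) :=
    lt_of_lt_of_le h3 (by gcongr)
  rw [← ENNReal.ofReal_mul (by positivity), ← ENNReal.ofReal_one] at h5
  have h6 := (ENNReal.ofReal_lt_ofReal_iff'.mp h5).1
  rw [Real.rpow_neg hpos.le, inv_le_iff_one_le_mul₀ (by positivity)]
  linarith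

lemma mm_seq {n : ℕ} (hn : 1 ≤ n) (ξ : Fin (n + 1) → ℝ) (hξ : LinearIndependent ℚ ξ)
    (S : Set (Fin (n + 1) → ℤ)) (α : ℝ) (hα : 0 < α) (X0 : ℝ) (hX0 : 1 ≤ X0)
    (h : ∀ X, X0 ≤ X → ∃ x ∈ S, x ≠ 0 ∧ inorm x ≤ X ∧ Lxi ξ x ≤ X ^ (-α)) :
    ∃ x : ℕ → Fin (n + 1) → ℤ, (∀ i, x i ∈ S ∧ x i ≠ 0) ∧ (∀ i, inorm (x i) ≤ inorm (x (i + 1))) ∧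
      (∀ i, Lxi ξ (x (i + 1)) < Lxi ξ (x i)) ∧ Tendsto (fun i => inorm (x i)) atTop atTop ∧
      ∀ᶠ i in atTop, Lxi ξ (x i) ≤ inorm (x (i + 1)) ^ (-α) := by
  classical
  have hex : ∀ l : ℝ, ∃ x : Fin (n + 1) → ℤ, 0 < l → (x ∈ S ∧ x ≠ 0 ∧ Lxi ξ x < l ∧
      ∀ y ∈ S, y ≠ 0 → Lxi ξ y < l → inorm x ≤ inorm y) := by
    intro l
    by_cases hl : 0 < l
    · have h1 : ∃ N : ℕ, ∃ x ∈ S, x ≠ 0 ∧ Lxi ξ x < l ∧ ∑ k, (x k).natAbs ^ 2 = N := by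
        have h2 := (tendsto_rpow_neg_atTop hα).eventually_lt_const hl
        obtain ⟨X, hX1, hX2⟩ := (h2.and (eventually_ge_atTop X0)).exists
        obtain ⟨x, a1, a2, a3, a4⟩ := h X hX2
        exact ⟨_, x, a1, a2, lt_of_le_of_lt a4 hX1, rfl⟩
      obtain ⟨x, a1, a2, a3, a4⟩ := Nat.find_spec h1
      refine ⟨x, fun _ => ⟨a1, a2, a3, fun y b1 b2 b3 => ?_⟩⟩
      have h3 := Nat.find_min' h1 ⟨y, b1, b2, b3, rfl⟩
      rw [← a4] at h3
      have h4 : ∀ z : Fin (n + 1) → ℤ, ∑ k, ((z k : ℝ)) ^ 2 = ((∑ k, (z k).natAbs ^ 2 : ℕ) : ℝ) := by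
        intro z
        push_cast
        refine Finset.sum_congr rfl fun k _ => ?_
        rw [Nat.cast_natAbs, Int.cast_abs, sq_abs]
      unfold inorm
      rw [h4, h4]
      exact Real.sqrt_le_sqrt (by exact_mod_cast h3)
    · exact ⟨0, fun h => absurd h hl⟩
  choose pick hpick using hex
  let x : ℕ → Fin (n + 1) → ℤ := fun i => Nat.rec (pick 1) (fun _ y => pick (Lxi ξ y)) i
  have x0 : x 0 = pick 1 := rfl
  have xs : ∀ i, x (i + 1) = pick (Lxi ξ (x i)) := fun i => rfl
  have hx : ∀ i, x i ∈ S ∧ x i ≠ 0 := by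
    intro i
    induction i with
    | zero => exact ⟨(hpick 1 one_pos).1, (hpick 1 one_pos).2.1⟩
    | succ i ih =>
      have := hpick _ (Lxi_pos hn ξ hξ _ ih.2)
      rw [xs]; exact ⟨this.1, this.2.1⟩
  have hp := fun i => hpick _ (Lxi_pos hn ξ hξ _ (hx i).2)
  have hL : ∀ i, Lxi ξ (x (i + 1)) < Lxi ξ (x i) := fun i => (hp i).2.2.1
  have hmin : ∀ i, ∀ y ∈ S, y ≠ 0 → Lxi ξ y < Lxi ξ (x i) → inorm (x (i + 1)) ≤ inorm y :=
    fun i => (hp i).2.2.2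
  have hX : ∀ i, inorm (x i) ≤ inorm (x (i + 1)) := by
    intro i
    cases i with
    | zero =>
      refine (hpick 1 one_pos).2.2.2 _ (hx 1).1 (hx 1).2 ?_
      exact (hL 0).trans (hpick 1 one_pos).2.2.1
    | succ i =>
      exact hmin i _ (hx (i + 1 + 1)).1 (hx (i + 1 + 1)).2 ((hL (i + 1)).trans (hL i))
  have htend : Tendsto (fun i => inorm (x i)) atTop atTop := by
    refine tendsto_atTop_atTop_of_monotone' (monotone_nat_of_le_succ hX) ?_
    rintro ⟨R, hR⟩
    have hanti : StrictAnti (fun i => Lxi ξ (x i)) := strictAnti_nat_of_succ_lt hL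
    have hinj : Function.Injective x := fun i j hij =>
      hanti.injective (by simp only [hij])
    refine Set.infinite_range_of_injective hinj ?_
    refine Set.Finite.subset (Set.finite_Icc (fun _ => -⌈R⌉) (fun _ => ⌈R⌉)) ?_
    rintro _ ⟨i, rfl⟩
    have h1 : inorm (x i) ≤ R := hR ⟨i, rfl⟩
    have h2 : ∀ k, |x i k| ≤ ⌈R⌉ := by
      intro k
      have := (abs_le_inorm (x i) k).trans (h1.trans (Int.le_ceil R))
      exact_mod_cast this
    exact ⟨fun k => (abs_le.mp (h2 k)).1, fun k => (abs_le.mp (h2 k)).2⟩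
  refine ⟨x, hx, hX, hL, htend, ?_⟩
  filter_upwards [(tendsto_add_atTop_iff_nat 1).mpr htend |>.eventually_gt_atTop X0] with i hi
  set Y := inorm (x (i + 1)) with hY
  have hYpos : 0 < Y := by linarith
  have hcont : Tendsto (fun X : ℝ => X ^ (-α)) (nhdsWithin Y (Set.Iio Y)) (nhds (Y ^ (-α))) :=
    (Real.continuousAt_rpow_const Y (-α) (Or.inl hYpos.ne')).tendsto.mono_left nhdsWithin_le_nhds
  refine ge_of_tendsto hcont ?_
  filter_upwards [Ioo_mem_nhdsLT hi] with X hXm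
  obtain ⟨y, a1, a2, a3, a4⟩ := h X hXm.1.le
  refine le_trans ?_ a4
  by_contra hc
  have := hmin i y a1 a2 (not_le.mp hc)
  linarith [hXm.2]

/-- One elimination step: the part of `y` off the line through `x`. -/
lemma mm_step {n : ℕ} (ξ : Fin (n + 1) → ℝ) (hξ0 : ξ 0 ≠ 0) (c : ℝ) (hc : 0 < c)
    (x y : Fin (n + 1) → ℤ) (hx : x ≠ 0) (hx0 : c * inorm x ≤ |(x 0 : ℝ)|)
    (hxy : inorm x ≤ inorm y) (hL : Lxi ξ y ≤ Lxi ξ x) (k : Fin (n + 1)) :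
    |(y k : ℝ) - ((y 0 : ℝ) / (x 0 : ℝ)) * (x k : ℝ)| ≤
      ((1 + 1 / c) / |ξ 0|) * (inorm y * Lxi ξ x / inorm x) := by
  have hX := one_le_inorm x hx
  have hXpos : 0 < inorm x := by linarith
  have hx0pos : 0 < |(x 0 : ℝ)| := lt_of_lt_of_le (by positivity) hx0
  have hx0ne : (x 0 : ℝ) ≠ 0 := abs_pos.mp hx0pos
  have hξpos : 0 < |ξ 0| := abs_pos.mpr hξ0
  have hLx := Lxi_nonneg ξ x
  have e : (y k : ℝ) - ((y 0 : ℝ) / (x 0 : ℝ)) * (x k : ℝ) =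
      ((ξ 0 * (y k : ℝ) - ξ k * (y 0 : ℝ)) -
        ((y 0 : ℝ) / (x 0 : ℝ)) * (ξ 0 * (x k : ℝ) - ξ k * (x 0 : ℝ))) / ξ 0 := by
    field_simp
    ring
  rw [e, abs_div, div_mul_eq_mul_div (1 + 1 / c) |ξ 0|]
  refine div_le_div_of_nonneg_right ?_ hξpos.le
  refine (abs_sub _ _).trans ?_
  rw [abs_mul, abs_div]
  have h1 := abs_le_Lxi ξ y k
  have h2 := abs_le_Lxi ξ x k
  have h3 := abs_le_inorm y 0
  have h4 : |(y 0 : ℝ)| / |(x 0 : ℝ)| ≤ inorm y / (c * inorm x) := by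
    gcongr
    exact (inorm_nonneg y)
  have h5 : Lxi ξ x ≤ inorm y * Lxi ξ x / inorm x := by
    rw [le_div_iff₀ hXpos]
    nlinarith
  have h6 : |(y 0 : ℝ)| / |(x 0 : ℝ)| * |ξ 0 * (x k : ℝ) - ξ k * (x 0 : ℝ)| ≤
      inorm y / (c * inorm x) * Lxi ξ x := by
    gcongr
    exact div_nonneg (inorm_nonneg y) (by positivity)
  have h7 : inorm y / (c * inorm x) * Lxi ξ x = 1 / c * (inorm y * Lxi ξ x / inorm x) := by
    field_simp
  rw [add_mul, one_mul]
  linarith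

lemma mm_x0 {n : ℕ} (ξ : Fin (n + 1) → ℝ) (hξ0 : ξ 0 ≠ 0) :
    ∃ c B : ℝ, 0 < c ∧ ∀ x : Fin (n + 1) → ℤ, Lxi ξ x ≤ 1 → B ≤ inorm x →
      c * inorm x ≤ |(x 0 : ℝ)| := by
  have hξpos : 0 < |ξ 0| := abs_pos.mpr hξ0
  set A := ∑ k, |ξ k| with hA
  have hk : ∀ k, |ξ k| ≤ A := fun k =>
    Finset.single_le_sum (f := fun k => |ξ k|) (fun i _ => abs_nonneg _) (Finset.mem_univ k)
  have hApos : 0 < A := lt_of_lt_of_le hξpos (hk 0)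
  have hn : (0 : ℝ) < n + 1 := by positivity
  refine ⟨|ξ 0| / (2 * (n + 1) * A), 2 * (n + 1) / |ξ 0|, by positivity, ?_⟩
  intro x hL hB
  have h1 : inorm x ≤ (n + 1) * ((1 + A * |(x 0 : ℝ)|) / |ξ 0|) := by
    apply inorm_le_of _ _ (by positivity)
    intro k
    rw [le_div_iff₀ hξpos]
    have h2 := (abs_le_Lxi ξ x k).trans hL
    have h3 : |ξ 0 * (x k : ℝ)| ≤ |ξ 0 * (x k : ℝ) - ξ k * (x 0 : ℝ)| + |ξ k * (x 0 : ℝ)| := by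
      have := abs_add_le (ξ 0 * (x k : ℝ) - ξ k * (x 0 : ℝ)) (ξ k * (x 0 : ℝ))
      simpa using this
    rw [abs_mul, abs_mul] at h3
    have h4 : |ξ k| * |(x 0 : ℝ)| ≤ A * |(x 0 : ℝ)| := by gcongr; exact hk k
    linarith [mul_comm |ξ 0| |(x k : ℝ)|]
  rw [div_le_iff₀ hξpos] at hB
  have h2 : inorm x * |ξ 0| ≤ (n + 1) * (1 + A * |(x 0 : ℝ)|) := by
    have := mul_le_mul_of_nonneg_right h1 hξpos.le
    rwa [mul_assoc, div_mul_cancel₀ _ hξpos.ne'] at this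
  rw [div_mul_eq_mul_div, div_le_iff₀ (by positivity)]
  nlinarith

lemma mm_span {n : ℕ} (ξ : Fin (n + 1) → ℝ) (hξ : LinearIndependent ℚ ξ) (hξ0 : ξ 0 ≠ 0)
    (x : ℕ → Fin (n + 1) → ℤ) (c : ℝ) (hc : 0 < c)
    (h0 : ∀ᶠ i in atTop, c * inorm (x i) ≤ |(x i 0 : ℝ)|)
    (hL : ∀ᶠ i in atTop, Lxi ξ (x i) ≤ 1)
    (hX : Tendsto (fun i => inorm (x i)) atTop atTop) (a : ℕ)
    (W : Submodule ℚ (Fin (n + 1) → ℚ)) (hW : W ≠ ⊤) :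
    ∃ m, a ≤ m ∧ (fun k => (x m k : ℚ)) ∉ W := by
  by_contra hcon
  push Not at hcon
  obtain ⟨f, hf0, hf⟩ := Submodule.exists_le_ker_of_lt_top W (lt_top_iff_ne_top.mpr hW)
  let u : Fin (n + 1) → ℚ := fun k => f (Pi.single k 1)
  have hfu : ∀ v, f v = ∑ k, v k * u k := by
    intro v
    rw [LinearMap.pi_apply_eq_sum_univ f v]
    refine Finset.sum_congr rfl fun k _ => ?_
    rw [smul_eq_mul]
    congr 2
    ext j
    simp [Pi.single_apply, eq_comm]
  have hsum : ∀ m, a ≤ m → ∑ k, (x m k : ℝ) * (u k : ℝ) = 0 := by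
    intro m hm
    have h1 := hf (hcon m hm)
    rw [LinearMap.mem_ker, hfu] at h1
    exact_mod_cast h1
  set q : ℝ := ∑ k, ξ k * (u k : ℝ) with hq
  set U : ℝ := ∑ k, |(u k : ℝ)| with hU
  have hbound : ∀ m, a ≤ m → |(x m 0 : ℝ)| * |q| ≤ Lxi ξ (x m) * U := by
    intro m hm
    have e : (x m 0 : ℝ) * q = - ∑ k, (ξ 0 * (x m k : ℝ) - ξ k * (x m 0 : ℝ)) * (u k : ℝ) := by
      have h1 : ∑ k, (ξ 0 * (x m k : ℝ) - ξ k * (x m 0 : ℝ)) * (u k : ℝ)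
          = ξ 0 * ∑ k, (x m k : ℝ) * (u k : ℝ) - (x m 0 : ℝ) * q := by
        rw [hq, Finset.mul_sum, Finset.mul_sum, ← Finset.sum_sub_distrib]
        exact Finset.sum_congr rfl fun k _ => by ring
      rw [h1, hsum m hm]; ring
    rw [← abs_mul, e, abs_neg, hU, Finset.mul_sum]
    refine (Finset.abs_sum_le_sum_abs _ _).trans (Finset.sum_le_sum fun k _ => ?_)
    rw [abs_mul]
    gcongr
    exact abs_le_Lxi ξ (x m) k
  have hUnn : 0 ≤ U := Finset.sum_nonneg fun _ _ => abs_nonneg _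
  have hq0 : q = 0 := by
    by_contra hne
    have hqpos : 0 < |q| := abs_pos.mpr hne
    have hbig := hX.eventually_gt_atTop (U / (c * |q|))
    obtain ⟨m, ⟨⟨⟨a1, a2⟩, a3⟩, a4⟩⟩ :=
      (((h0.and hL).and hbig).and (eventually_ge_atTop a)).exists
    have h1 := hbound m a4
    rw [div_lt_iff₀ (by positivity)] at a3
    have h2 : Lxi ξ (x m) * U ≤ 1 * U := by gcongr
    have h3 : c * inorm (x m) * |q| ≤ |(x m 0 : ℝ)| * |q| := by gcongr
    nlinarith
  have hu0 := (Fintype.linearIndependent_iff.mp hξ) u (by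
    rw [← hq0, hq]
    exact Finset.sum_congr rfl fun k _ => by rw [Rat.smul_def]; ring)
  apply hf0
  ext v
  simp [u] at hu0
  simp [hu0]

/-- The core: bounds on a sequence of points are incompatible with violation. -/
lemma mm_core {n : ℕ} (hn : 1 ≤ n) (ξ : Fin (n + 1) → ℝ) (hξ : LinearIndependent ℚ ξ)
    (x : ℕ → Fin (n + 1) → ℤ) (α β : ℝ) (hα : 0 < α) (hβ : 0 < β)
    (hx : ∀ i, x i ≠ 0) (hX : ∀ i, inorm (x i) ≤ inorm (x (i + 1)))
    (hL : ∀ i, Lxi ξ (x (i + 1)) < Lxi ξ (x i))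
    (hT : Tendsto (fun i => inorm (x i)) atTop atTop)
    (hhat : ∀ᶠ i in atTop, Lxi ξ (x i) ≤ inorm (x (i + 1)) ^ (-α))
    (hord : ∀ᶠ i in atTop, inorm (x i) ^ (-β) ≤ Lxi ξ (x i)) :
    α * ∑ k ∈ Finset.range n, (α / β) ^ k ≤ 1 := by
  by_contra hviol
  push Not at hviol
  have hξ0 : ξ 0 ≠ 0 := hξ.ne_zero 0
  obtain ⟨c, B, hc, hcB⟩ := mm_x0 ξ hξ0
  have hX1 : ∀ i, 1 ≤ inorm (x i) := fun i => one_le_inorm _ (hx i)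
  have hXpos : ∀ i, 0 < inorm (x i) := fun i => by linarith [hX1 i]
  have hLpos : ∀ i, 0 < Lxi ξ (x i) := fun i => Lxi_pos hn ξ hξ _ (hx i)
  have hL1 : ∀ᶠ i in atTop, Lxi ξ (x i) ≤ 1 := by
    filter_upwards [hhat] with i hi
    exact hi.trans (Real.rpow_le_one_of_one_le_of_nonpos (hX1 _) (by linarith))
  have h0 : ∀ᶠ i in atTop, c * inorm (x i) ≤ |(x i 0 : ℝ)| := by
    filter_upwards [hL1, hT.eventually_ge_atTop B] with i h1 h2
    exact hcB _ h1 h2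
  obtain ⟨δ, hδ, harith⟩ := mm_arith n hn α (α / β) hα (by positivity) hviol
  set C := (1 + 1 / c) / |ξ 0| with hC
  have hCpos : 0 < C := by
    have := abs_pos.mpr hξ0
    positivity
  set D : ℝ := ((n + 1).factorial : ℝ) * C ^ n with hD
  have hDpos : 0 < D := by positivity
  have hlog : Tendsto (fun i => Real.log (inorm (x i))) atTop atTop :=
    Real.tendsto_log_atTop.comp hT
  obtain ⟨a, ha⟩ := Filter.eventually_atTop.mp ((h0.and hhat).and hord)
  obtain ⟨aa, hst1, hst2⟩ := ((hlog.eventually_gt_atTop (Real.log D / δ)).and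
    (eventually_ge_atTop a)).exists
  have hstep : ∀ m, aa ≤ m → ∀ k, |(x (m + 1) k : ℝ) - ((x (m + 1) 0 : ℝ) / (x m 0 : ℝ)) * (x m k : ℝ)| ≤
      C * (inorm (x (m + 1)) * Lxi ξ (x m) / inorm (x m)) := fun m hm k =>
    mm_step ξ hξ0 c hc _ _ (hx m) (ha m (by omega)).1.1 (hX m) (hL m).le k
  obtain ⟨s, hs0, hslt, hsLI, hsmem⟩ := mm_chain (n := n) (K := ℚ) (E := Fin (n + 1) → ℚ) (by simp)
    (fun i k => (x i k : ℚ)) aa (by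
      intro h
      apply hx aa
      ext k
      have := congrFun h k
      simpa using this)
    (fun W hW => mm_span ξ hξ hξ0 x c hc h0 hL1 hT aa W hW)
  have hsa : ∀ d, d ≤ n → aa ≤ s d := by
    intro d
    induction d with
    | zero => intro _; exact hs0.ge
    | succ d ih => intro h; have := hslt d (by omega); have := ih (by omega); omega
  have hmono : Monotone (fun i => inorm (x i)) := monotone_nat_of_le_succ hX
  -- the determinant
  let y : Matrix (Fin (n + 1)) (Fin (n + 1)) ℤ := fun e k => x (s e) k
  have hdet : y.det ≠ 0 := by
    have h1 : IsUnit (y.map (Int.castRingHom ℚ)) := by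
      rw [← Matrix.linearIndependent_rows_iff_isUnit]
      exact hsLI
    rw [Matrix.isUnit_iff_isUnit_det] at h1
    intro h2
    have h3 := (Int.castRingHom ℚ).map_det y
    rw [h2, map_zero] at h3
    have h4 := h1.ne_zero
    exact h4 h3.symm
  have hcoef : ∀ i : Fin (n + 1), ∃ t : Fin (n + 1) → ℝ, (∀ j, i ≤ j → t j = 0) ∧
      ∀ k, |(y i k : ℝ) - ∑ j, t j * (y j k : ℝ)| ≤
        (Fin.cons (inorm (x aa)) (fun d : Fin n => C * (inorm (x (s (d + 1))) *
          Lxi ξ (x (s (d + 1) - 1)) / inorm (x (s (d + 1) - 1)))) : Fin (n + 1) → ℝ) i := by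
    intro i
    refine Fin.cases ?_ (fun d => ?_) i
    · refine ⟨0, fun _ _ => rfl, fun k => ?_⟩
      simp only [Pi.zero_apply, zero_mul, Finset.sum_const_zero, sub_zero, Fin.cons_zero]
      have : y 0 k = x aa k := by simp [y, hs0]
      rw [this]
      exact abs_le_inorm _ _
    · have hd := d.2
      obtain ⟨w, hw⟩ := (Submodule.mem_span_range_iff_exists_fun ℚ).mp (hsmem d hd)
      have hlt := hslt d hd
      have hge := hsa d hd.le
      obtain ⟨m, hm⟩ : ∃ m, s (d + 1) = m + 1 := ⟨s (d + 1) - 1, by omega⟩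
      rw [hm, Nat.add_sub_cancel] at hw
      set r : ℝ := (x (m + 1) 0 : ℝ) / (x m 0 : ℝ) with hr
      refine ⟨fun j => if h : (j : ℕ) < d + 1 then r * (w ⟨j, h⟩ : ℝ) else 0, ?_, ?_⟩
      · intro j hj
        refine dif_neg ?_
        have : ((d.succ : Fin (n + 1)) : ℕ) ≤ j := hj
        simp at this
        omega
      · intro k
        have hwk : (x m k : ℝ) = ∑ j : Fin (d + 1), (w j : ℝ) * (x (s j) k : ℝ) := by
          have h1 := congrFun hw k
          simp only [Finset.sum_apply, Pi.smul_apply, smul_eq_mul] at h1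
          have h2 : ((x m k : ℚ) : ℝ) = ((∑ j : Fin (d + 1), w j * (x (s j) k : ℚ) : ℚ) : ℝ) := by
            rw [h1]
          push_cast at h2
          exact h2
        have hsumk : ∑ j : Fin (n + 1), (if h : (j : ℕ) < d + 1 then r * (w ⟨j, h⟩ : ℝ) else 0) *
            (y j k : ℝ) = r * (x m k : ℝ) := by
          rw [hwk, Finset.mul_sum]
          let g : ℕ → ℝ := fun j => (if h : j < d + 1 then r * (w ⟨j, h⟩ : ℝ) else 0) *
            (x (s j) k : ℝ)
          have e1 : ∑ j : Fin (n + 1), (if h : (j : ℕ) < d + 1 then r * (w ⟨j, h⟩ : ℝ) else 0) *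
            (y j k : ℝ) = ∑ j ∈ Finset.range (n + 1), g j := (Finset.sum_range g).symm
          have e2 : ∑ j : Fin (d + 1), r * ((w j : ℝ) * (x (s j) k : ℝ)) =
              ∑ j ∈ Finset.range (d + 1), g j := by
            rw [Finset.sum_range g]
            refine Finset.sum_congr rfl fun j _ => ?_
            simp only [g]
            rw [dif_pos j.2]
            ring
          rw [e1, e2]
          symm
          apply Finset.sum_subset
          · intro j; simp; omega
          · intro j _ hj
            simp only [Finset.mem_range] at hj
            simp only [g]
            rw [dif_neg hj, zero_mul]
        rw [hsumk]
        have := hstep m (by omega) k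
        simp only [Fin.cons_succ, hm, Nat.add_sub_cancel]
        have hy : y d.succ k = x (m + 1) k := by simp [y, hm]
        rw [hy]
        exact this
  choose t ht0 htb using hcoef
  have hmain := mm_det y hdet t (fun i j h => ht0 i j h) _ htb
  rw [Fin.prod_univ_succ] at hmain
  simp only [Fin.cons_zero, Fin.cons_succ] at hmain
  rw [Finset.prod_mul_distrib, Finset.prod_const, Finset.card_univ, Fintype.card_fin,
    ← Finset.prod_range (fun d => inorm (x (s (d + 1))) *
          Lxi ξ (x (s (d + 1) - 1)) / inorm (x (s (d + 1) - 1)))] at hmain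
  have hfac : ∀ d, 0 < inorm (x (s (d + 1))) *
          Lxi ξ (x (s (d + 1) - 1)) / inorm (x (s (d + 1) - 1)) := fun d =>
    div_pos (mul_pos (hXpos _) (hLpos _)) (hXpos _)
  have hmain2 : 1 ≤ D * (inorm (x aa) * ∏ d ∈ Finset.range n, (inorm (x (s (d + 1))) *
          Lxi ξ (x (s (d + 1) - 1)) / inorm (x (s (d + 1) - 1)))) := by
    rw [hD]; linarith
  have hlog2 := Real.log_nonneg hmain2
  have hprodpos := Finset.prod_pos (s := Finset.range n) (fun d _ => hfac d)
  rw [Real.log_mul hDpos.ne' (mul_pos (hXpos _) hprodpos).ne',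
    Real.log_mul (hXpos _).ne' hprodpos.ne', Real.log_prod (fun d _ => (hfac d).ne')] at hlog2
  have hLlog : ∀ m, aa ≤ m → Real.log (Lxi ξ (x m)) ≤ -α * Real.log (inorm (x (m + 1))) := by
    intro m hm
    have h1 := Real.log_le_log (hLpos m) (ha m (by omega)).1.2
    rwa [Real.log_rpow (hXpos _)] at h1
  have hLlog2 : ∀ m, aa ≤ m → -β * Real.log (inorm (x m)) ≤ Real.log (Lxi ξ (x m)) := by
    intro m hm
    have h1 := Real.log_le_log (Real.rpow_pos_of_pos (hXpos m) _) (ha m (by omega)).2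
    rwa [Real.log_rpow (hXpos _)] at h1
  have hfin := harith (fun d => Real.log (inorm (x (s d)))) (fun d => Real.log (inorm (x (s d - 1))))
    (Real.log_nonneg (hX1 _))
    (fun d hd => Real.log_le_log (hXpos _) (hmono (by have := hslt d hd; omega)))
    (fun d hd => Real.log_le_log (hXpos _) (hmono (by omega)))
    (fun d hd => by
      have hlt := hslt d hd
      have hge := hsa d hd.le
      obtain ⟨m, hm⟩ : ∃ m, s (d + 1) = m + 1 := ⟨s (d + 1) - 1, by omega⟩
      simp only [hm, Nat.add_sub_cancel]
      have h1 := hLlog m (by omega)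
      have h2 := hLlog2 m (by omega)
      rw [div_mul_eq_mul_div, div_le_iff₀ hβ]
      linarith)
  have hsumle : ∑ d ∈ Finset.range n, Real.log (inorm (x (s (d + 1))) *
          Lxi ξ (x (s (d + 1) - 1)) / inorm (x (s (d + 1) - 1))) ≤
      ∑ d ∈ Finset.range n, ((1 - α) * Real.log (inorm (x (s (d + 1)))) -
        Real.log (inorm (x (s (d + 1) - 1)))) := by
    refine Finset.sum_le_sum fun d hd => ?_
    have hd := Finset.mem_range.mp hd
    have hlt := hslt d hd
    have hge := hsa d hd.le
    obtain ⟨m, hm⟩ : ∃ m, s (d + 1) = m + 1 := ⟨s (d + 1) - 1, by omega⟩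
    simp only [hm, Nat.add_sub_cancel]
    rw [Real.log_div (mul_pos (hXpos _) (hLpos _)).ne' (hXpos _).ne',
      Real.log_mul (hXpos _).ne' (hLpos _).ne']
    have h1 := hLlog m (by omega)
    linarith
  simp only [hs0] at hfin
  rw [div_lt_iff₀ hδ] at hst1
  linarith

lemma lamHat_le_lamOrd {n : ℕ} (ξ : Fin (n + 1) → ℝ) (S : Set (Fin (n + 1) → ℤ)) :
    lamHat ξ S ≤ lamOrd ξ S := by
  unfold lamHat lamOrd
  apply sSup_le_sSup
  rintro l ⟨t, h1, h2, h3⟩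
  exact ⟨t, h1, h2, lt_of_le_of_lt (Filter.liminf_le_limsup) h3⟩

/-- Marnat–Moshchevitin inequality relative to a subset `S ⊆ ℤ^{n+1}`: if
`λ̂(ξ;S) > 0` and `λ(ξ;S) < ∞`, then
`λ̂(ξ;S) + λ̂(ξ;S)²/λ(ξ;S) + ⋯ + λ̂(ξ;S)ⁿ/λ(ξ;S)^{n−1} ≤ 1`. -/
theorem marnat_moshchevitin_relative (n : ℕ) (hn : 1 ≤ n) (ξ : Fin (n + 1) → ℝ)
    (hξ : LinearIndependent ℚ ξ) (S : Set (Fin (n + 1) → ℤ))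
    (hpos : 0 < lamHat ξ S) (hfin : lamOrd ξ S < ⊤) :
    ∑ k ∈ Finset.Icc 1 n, (lamHat ξ S).toReal ^ k / (lamOrd ξ S).toReal ^ (k - 1) ≤ 1 := by
  have hle := lamHat_le_lamOrd ξ S
  have hhatfin : lamHat ξ S < ⊤ := lt_of_le_of_lt hle hfin
  have ha : 0 < (lamHat ξ S).toReal := ENNReal.toReal_pos hpos.ne' hhatfin.ne
  have hab : (lamHat ξ S).toReal ≤ (lamOrd ξ S).toReal := ENNReal.toReal_mono hfin.ne hle
  have hb : 0 < (lamOrd ξ S).toReal := lt_of_lt_of_le ha hab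
  have hatof : ENNReal.ofReal (lamHat ξ S).toReal = lamHat ξ S := ENNReal.ofReal_toReal hhatfin.ne
  have ordof : ENNReal.ofReal (lamOrd ξ S).toReal = lamOrd ξ S := ENNReal.ofReal_toReal hfin.ne
  generalize hA : (lamHat ξ S).toReal = A at *
  generalize hBB : (lamOrd ξ S).toReal = B at *
  have hsum : ∑ k ∈ Finset.Icc 1 n, A ^ k / B ^ (k - 1) =
      A * ∑ k ∈ Finset.range n, (A / B) ^ k := by
    rw [Finset.mul_sum, ← Finset.Ico_add_one_right_eq_Icc, Finset.sum_Ico_eq_sum_range]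
    simp only [Nat.add_sub_cancel]
    refine Finset.sum_congr rfl fun k _ => ?_
    rw [Nat.add_sub_cancel_left, div_pow, pow_add, pow_one, mul_div_assoc]
  rw [hsum]
  have hcore : ∀ α β, 0 < α → α < A → B < β → α * ∑ k ∈ Finset.range n, (α / β) ^ k ≤ 1 := by
    intro α β hα hαA hBβ
    obtain ⟨X0, hX0, h1⟩ := mm_hat ξ S α (by
      rw [← hatof]; exact (ENNReal.ofReal_lt_ofReal_iff ha).mpr hαA)
    obtain ⟨X1, h2⟩ := mm_ord ξ S β (by linarith) (by
      rw [← ordof]; exact (ENNReal.ofReal_lt_ofReal_iff (by linarith)).mpr hBβ)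
    obtain ⟨x, hx, hX, hL, hT, hh⟩ := mm_seq hn ξ hξ S α hα X0 hX0 h1
    refine mm_core hn ξ hξ x α β hα (by linarith) (fun i => (hx i).2) hX hL hT hh ?_
    filter_upwards [hT.eventually_ge_atTop X1] with i hi
    exact h2 _ (hx i).1 (hx i).2 hi
  -- pass to the limit
  have hlim : Tendsto (fun e : ℝ => (A - e) * ∑ k ∈ Finset.range n, ((A - e) / (B + e)) ^ k)
      (nhdsWithin 0 (Set.Ioi 0)) (nhds (A * ∑ k ∈ Finset.range n, (A / B) ^ k)) := by
    have hcont : ContinuousAt (fun e : ℝ => (A - e) * ∑ k ∈ Finset.range n,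
        ((A - e) / (B + e)) ^ k) 0 := by
      have : ContinuousAt (fun e : ℝ => (A - e) / (B + e)) 0 :=
        ContinuousAt.div (by fun_prop) (by fun_prop) (by simpa using hb.ne')
      fun_prop
    have := hcont.tendsto.mono_left (nhdsWithin_le_nhds (s := Set.Ioi 0))
    simpa using this
  refine le_of_tendsto hlim ?_
  filter_upwards [Ioo_mem_nhdsGT ha] with e he
  exact hcore _ _ (by linarith [he.2]) (by linarith [he.1]) (by linarith [he.1])
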